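/- For no ε > 0 does there exist a sequence of Delzant polygons Δ⁰, Δ¹, Δ², Δ³, Δ⁴ with Δ⁰ = Δ₁ (the Delzant triangle of size 1) such that each Δⁱ is obtained from Δⁱ⁻¹ by a corner chopping of size ε. That is, one cannot perform four successive corner choppings of equal sizes starting from the Delzant triangle of size 1. -/

import Mathlib

open Set Finset MeasureTheory

/-- Points of ℝⁿ. -/
abbrev Pt (n : ℕ) := Fin n → ℝ

/-- A convex polytope in ℝⁿ: a compact convex set with nonempty interior and
finitely many extreme points. -/
def IsConvexPolytope {n : ℕ} (Δ : Set (Pt n)) : Prop :=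
  IsCompact Δ ∧ Convex ℝ Δ ∧ (interior Δ).Nonempty ∧ (Set.extremePoints ℝ Δ).Finite

/-- An edge (one-dimensional face) of a polytope: a nondegenerate closed segment
that is an extreme subset of the polytope. -/
def IsEdge {n : ℕ} (Δ e : Set (Pt n)) : Prop :=
  (∃ a b : Pt n, a ≠ b ∧ e = segment ℝ a b) ∧ IsExtreme ℝ Δ e

/-- A family of vectors of ℝⁿ forming a basis of the lattice ℤⁿ. -/
def IsLatticeBasis {n : ℕ} (α : Fin n → Pt n) : Prop :=
  ∃ A : Matrix (Fin n) (Fin n) ℤ, IsUnit A.det ∧ ∀ j i, α j i = (A j i : ℝ)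

/-- The Delzant condition at the vertex `v`: the edges emanating from `v` have the
form `{v + s • α j : 0 ≤ s ≤ ℓ j}` where the `α j` form a basis of the lattice ℤⁿ. -/
def DelzantAt {n : ℕ} (Δ : Set (Pt n)) (v : Pt n) : Prop :=
  ∃ (α : Fin n → Pt n) (ℓ : Fin n → ℝ), IsLatticeBasis α ∧ (∀ j, 0 < ℓ j) ∧
    {e | IsEdge Δ e ∧ v ∈ e} = {e | ∃ j, e = segment ℝ v (v + ℓ j • α j)}

/-- A Delzant polytope in ℝⁿ. -/
def IsDelzant {n : ℕ} (Δ : Set (Pt n)) : Prop :=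
  IsConvexPolytope Δ ∧ ∀ v ∈ Set.extremePoints ℝ Δ, DelzantAt Δ v

/-- `Δ'` is obtained from `Δ` by a corner chopping of size `δ` at the vertex `v`. -/
def IsCornerChop {n : ℕ} (Δ : Set (Pt n)) (v : Pt n) (δ : ℝ) (Δ' : Set (Pt n)) : Prop :=
  v ∈ Set.extremePoints ℝ Δ ∧ 0 < δ ∧
  ∃ (α : Fin n → Pt n) (ℓ : Fin n → ℝ), IsLatticeBasis α ∧ (∀ j, δ < ℓ j) ∧
    {e | IsEdge Δ e ∧ v ∈ e} = {e | ∃ j, e = segment ℝ v (v + ℓ j • α j)} ∧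
    Δ' = Δ ∩ {x | ∃ s : Fin n → ℝ, x = v + ∑ j, s j • α j ∧ δ ≤ ∑ j, s j}

/-- An element of AGL(n,ℤ): an affine map `x ↦ A x + c` with `A ∈ GL(n,ℤ)`. -/
def IsAGL {n : ℕ} (g : Pt n → Pt n) : Prop :=
  ∃ (A : Matrix (Fin n) (Fin n) ℤ) (c : Pt n), IsUnit A.det ∧
    ∀ x, g x = (A.map (fun z : ℤ => (z : ℝ))).mulVec x + c

/-- Two subsets of ℝⁿ are AGL(n,ℤ)-congruent. -/
def AGLCongruent {n : ℕ} (S T : Set (Pt n)) : Prop :=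
  ∃ g : Pt n → Pt n, IsAGL g ∧ g '' S = T

/-- A primitive vector of ℤⁿ: nonzero and not a multiple `m • w` with `m ≥ 2`. -/
def IsPrimitive {n : ℕ} (v : Fin n → ℤ) : Prop :=
  v ≠ 0 ∧ ∀ m : ℕ, 2 ≤ m → ∀ w : Fin n → ℤ, v ≠ (m : ℤ) • w

/-- `d` is a segment of rational slope and rational length `ℓ`: its endpoints differ
by `ℓ • v` with `v` a primitive vector of ℤⁿ. -/
def RatLength {n : ℕ} (d : Set (Pt n)) (ℓ : ℝ) : Prop :=
  0 < ℓ ∧ ∃ (a : Pt n) (v : Fin n → ℤ), IsPrimitive v ∧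
    d = segment ℝ a (a + ℓ • fun i => (v i : ℝ))

/-- `P` is the (rational) perimeter of the polygon `Δ`: the sum of the rational
lengths of its edges. -/
def HasPerimeter (Δ : Set (Pt 2)) (P : ℝ) : Prop :=
  ∃ (E : Finset (Set (Pt 2))) (len : Set (Pt 2) → ℝ),
    (↑E = {e | IsEdge Δ e}) ∧ (∀ e ∈ E, RatLength e (len e)) ∧ P = ∑ e ∈ E, len e

/-- The Delzant triangle of size `lam`. -/
def DelzantTriangle (lam : ℝ) : Set (Pt 2) :=
  {x | 0 ≤ x 0 ∧ 0 ≤ x 1 ∧ x 0 + x 1 ≤ lam}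

/-- The Hirzebruch trapezoid with parameters `a`, `b`, `k`. -/
def Hirz (a b : ℝ) (k : ℕ) : Set (Pt 2) :=
  {x | -(b/2) ≤ x 1 ∧ x 1 ≤ b/2 ∧ 0 ≤ x 0 ∧ x 0 ≤ a - k * x 1}

/-- A linear functional on the plane with integer coefficients. -/
def IsIntegralFunctional (f : Pt 2 →ₗ[ℝ] ℝ) : Prop :=
  ∃ c : Fin 2 → ℤ, ∀ x, f x = c 0 * x 0 + c 1 * x 1

/-- The point `x` lies on an edge of `Δ` on which some integral functional varies by exactly `ε`;
when `w` is integral, this edge has rational length `ε`. -/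
def OnShortEdge (Δ : Set (Pt 2)) (ε : ℝ) (x : Pt 2) : Prop :=
  ∃ (a w : Pt 2) (f : Pt 2 →ₗ[ℝ] ℝ), IsIntegralFunctional f ∧ f w = 1 ∧
    IsEdge Δ (segment ℝ a (a + ε • w)) ∧ x ∈ segment ℝ a (a + ε • w)

/-- The vertices of `Δ` that lie on no edge of length `ε`. -/
def freeVertices (Δ : Set (Pt 2)) (ε : ℝ) : Set (Pt 2) :=
  {x | x ∈ Set.extremePoints ℝ Δ ∧ ¬ OnShortEdge Δ ε x}

lemma IsLatticeBasis.exists_dual {α : Fin 2 → Pt 2} (h : IsLatticeBasis α) :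
    ∃ φ ψ : Pt 2 →ₗ[ℝ] ℝ, φ (α 0) = 1 ∧ φ (α 1) = 0 ∧ ψ (α 0) = 0 ∧ ψ (α 1) = 1 ∧
      (∀ x, x = φ x • α 0 + ψ x • α 1) ∧ IsIntegralFunctional ψ := by
  obtain ⟨A, hdet, hA⟩ := h
  have hD : (A 0 0 * A 1 1 - A 0 1 * A 1 0) * (A 0 0 * A 1 1 - A 0 1 * A 1 0) = 1 := by
    rw [Matrix.det_fin_two] at hdet
    exact Int.isUnit_mul_self hdet
  set D : ℤ := A 0 0 * A 1 1 - A 0 1 * A 1 0 with hDdef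
  have hD' : (D : ℝ) * ((A 0 0 : ℝ) * A 1 1 - A 0 1 * A 1 0) = 1 := by
    rw [hDdef] at hD ⊢
    exact_mod_cast hD
  let P : Fin 2 → Pt 2 →ₗ[ℝ] ℝ := fun i => LinearMap.proj i
  refine ⟨((D * A 1 1 : ℤ) : ℝ) • P 0 + ((-D * A 1 0 : ℤ) : ℝ) • P 1,
    ((-D * A 0 1 : ℤ) : ℝ) • P 0 + ((D * A 0 0 : ℤ) : ℝ) • P 1, ?_, ?_, ?_, ?_, ?_,
    ![-D * A 0 1, D * A 0 0], fun x => by simp [P]⟩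
  · simp [P, hA]; linear_combination hD'
  · simp [P, hA]; ring
  · simp [P, hA]; ring
  · simp [P, hA]; linear_combination hD'
  · intro x
    ext i
    fin_cases i
    · simp [P, hA]; linear_combination (-x 0) * hD'
    · simp [P, hA]; linear_combination (-x 1) * hD'

/-- The line through an extreme segment of a planar convex set is a supporting line. -/
lemma le_of_isExtreme_segment {Δ : Set (Pt 2)} (hΔ : Convex ℝ Δ) {v α : Pt 2} {ℓ : ℝ}
    (hℓ : 0 < ℓ) (he : IsExtreme ℝ Δ (segment ℝ v (v + ℓ • α))) {f : Pt 2 →ₗ[ℝ] ℝ}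
    (hfα : f α = 0) (hker : ∀ x, f x = 0 → ∃ t : ℝ, x = t • α) {z : Pt 2} (hz : z ∈ Δ)
    (hvz : f v < f z) {y : Pt 2} (hy : y ∈ Δ) : f v ≤ f y := by
  by_contra! hyv
  have hconst : ∀ x ∈ segment ℝ v (v + ℓ • α), f x = f v := by
    rintro x hx
    rw [segment_eq_image'] at hx
    obtain ⟨t, -, rfl⟩ := hx
    simp [hfα]
  have hd : 0 < f z - f y := by linarith
  set p : Pt 2 := ((f z - f v) / (f z - f y)) • y + ((f v - f y) / (f z - f y)) • z with hp
  have hpos : 0 < (f z - f v) / (f z - f y) := div_pos (by linarith) hd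
  have hpos' : 0 < (f v - f y) / (f z - f y) := div_pos (by linarith) hd
  have hsum : (f z - f v) / (f z - f y) + (f v - f y) / (f z - f y) = 1 := by field_simp; ring
  have hpΔ : p ∈ Δ := hΔ hy hz hpos.le hpos'.le hsum
  have hfp : f (p - v) = 0 := by
    simp only [hp, map_sub, map_add, map_smul, smul_eq_mul]
    field_simp
    ring
  obtain ⟨t, ht⟩ := hker _ hfp
  have hpt : p = v + t • α := by rw [← ht]; abel
  have hv : v ∈ segment ℝ v (v + ℓ • α) := left_mem_segment _ _ _
  have hu : v + ℓ • α ∈ segment ℝ v (v + ℓ • α) := right_mem_segment _ _ _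
  have hpe : p ∈ segment ℝ v (v + ℓ • α) := by
    rcases lt_or_ge t 0 with h0 | h0
    · refine he.2 hpΔ (he.1 hu) hv ⟨ℓ / (ℓ - t), -t / (ℓ - t), ?_, ?_, ?_, ?_⟩
      · exact div_pos hℓ (by linarith)
      · exact div_pos (by linarith) (by linarith)
      · have : ℓ - t ≠ 0 := by linarith
        field_simp; ring
      · have : ℓ - t ≠ 0 := by linarith
        rw [hpt]
        ext i
        simp
        field_simp; ring
    · rcases le_or_gt t ℓ with h1 | h1
      · rw [segment_eq_image', hpt]
        refine ⟨t / ℓ, ⟨by positivity, by rwa [div_le_one hℓ]⟩, ?_⟩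
        have : t / ℓ * ℓ = t := by field_simp
        simp [smul_smul, this]
      · refine he.2 hpΔ (he.1 hv) hu ⟨ℓ / t, (t - ℓ) / t, ?_, ?_, ?_, ?_⟩
        · exact div_pos hℓ (by linarith)
        · exact div_pos (by linarith) (by linarith)
        · have : t ≠ 0 := by linarith
          field_simp; ring
        · have : t ≠ 0 := by linarith
          rw [hpt]
          ext i
          simp
          field_simp; ring
  have hye := he.2 hy hz hpe ⟨_, _, hpos, hpos', hsum, rfl⟩
  exact absurd (hconst y hye) hyv.ne

/-- Near a chopped corner the polygon is described by the coordinates dual to the edge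
directions. -/
lemma IsCornerChop.exists_coordinates {Δ Δ' : Set (Pt 2)} {v : Pt 2} {δ : ℝ} (hΔ : Convex ℝ Δ)
    (h : IsCornerChop Δ v δ Δ') :
    ∃ (a b : Pt 2) (φ ψ : Pt 2 →ₗ[ℝ] ℝ), φ a = 1 ∧ φ b = 0 ∧ ψ a = 0 ∧ ψ b = 1 ∧
      (∀ x, x = φ x • a + ψ x • b) ∧ IsIntegralFunctional ψ ∧
      (∀ x ∈ Δ, φ v ≤ φ x) ∧ (∀ x ∈ Δ, ψ v ≤ ψ x) ∧
      (∀ s t : ℝ, 0 ≤ s → 0 ≤ t → s + t ≤ δ → v + s • a + t • b ∈ Δ) ∧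
      Δ' = {x ∈ Δ | φ v + ψ v + δ ≤ φ x + ψ x} := by
  obtain ⟨hv, hδ, α, ℓ, hα, hℓ, hedge, rfl⟩ := h
  obtain ⟨φ, ψ, hφa, hφb, hψa, hψb, hrep, hψ⟩ := hα.exists_dual
  have hE : ∀ j, IsExtreme ℝ Δ (segment ℝ v (v + ℓ j • α j)) := fun j =>
    ((Set.ext_iff.1 hedge _).2 ⟨j, rfl⟩).1.2
  have hℓ0 : ∀ j, 0 < ℓ j := fun j => hδ.trans (hℓ j)
  have hmem : ∀ j, v + ℓ j • α j ∈ Δ := fun j => (hE j).1 (right_mem_segment _ _ _)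
  refine ⟨α 0, α 1, φ, ψ, hφa, hφb, hψa, hψb, hrep, hψ, ?_, ?_, ?_, ?_⟩
  · intro x hx
    refine le_of_isExtreme_segment hΔ (hℓ0 1) (hE 1) hφb (fun y hy => ⟨ψ y, ?_⟩) (hmem 0) ?_ hx
    · conv_lhs => rw [hrep y, hy, zero_smul, zero_add]
    · simp [hφa, hℓ0]
  · intro x hx
    refine le_of_isExtreme_segment hΔ (hℓ0 0) (hE 0) hψa (fun y hy => ⟨φ y, ?_⟩) (hmem 1) ?_ hx
    · conv_lhs => rw [hrep y, hy, zero_smul, add_zero]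
    · simp [hψb, hℓ0]
  · intro s t hs ht hst
    have h0 := hℓ 0
    have h1 := hℓ 1
    have hs' : s / ℓ 0 ≤ s / δ := by gcongr
    have ht' : t / ℓ 1 ≤ t / δ := by gcongr
    have hst' : s / δ + t / δ ≤ 1 := by rw [← add_div, div_le_one hδ]; exact hst
    have hc := hΔ.sum_mem (t := Finset.univ)
      (w := ![1 - s / ℓ 0 - t / ℓ 1, s / ℓ 0, t / ℓ 1])
      (z := ![v, v + ℓ 0 • α 0, v + ℓ 1 • α 1]) ?_ ?_ ?_
    · convert hc using 1
      have e0 := (hℓ0 0).ne'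
      have e1 := (hℓ0 1).ne'
      ext i
      simp [Fin.sum_univ_three]
      field_simp
      ring
    · have p0 := div_nonneg hs (hℓ0 0).le
      have p1 := div_nonneg ht (hℓ0 1).le
      intro i _
      fin_cases i
      · simp; linarith
      · simpa using p0
      · simpa using p1
    · simp [Fin.sum_univ_three]; ring
    · intro i _
      fin_cases i
      · exact hv.1
      · exact hmem 0
      · exact hmem 1
  · ext x
    simp only [Set.mem_inter_iff, Set.mem_ofPred_eq, Fin.sum_univ_two]
    refine and_congr_right fun _ => ⟨?_, fun h => ⟨![φ (x - v), ψ (x - v)], ?_, ?_⟩⟩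
    · rintro ⟨s, rfl, hs⟩
      simp [hφa, hφb, hψa, hψb]
      linarith
    · have := hrep (x - v)
      simp only [Matrix.cons_val_zero, Matrix.cons_val_one]
      rw [← this]; abel
    · simp
      linarith

/-- A corner lying on an edge of length `ε` cannot be chopped by size `ε`. -/
lemma IsCornerChop.not_onShortEdge {Δ Δ' : Set (Pt 2)} {v : Pt 2} {ε : ℝ}
    (h : IsCornerChop Δ v ε Δ') : ¬ OnShortEdge Δ ε v := by
  obtain ⟨-, hε, α, ℓ, ⟨A, -, hA⟩, hℓ, hedge, -⟩ := h
  rintro ⟨a, w, f, ⟨c, hc⟩, hfw, hE, hva⟩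
  obtain ⟨j, hj⟩ := (Set.ext_iff.1 hedge _).1 ⟨hE, hva⟩
  have hjℓ := hℓ j
  have hbound : ∀ x ∈ segment ℝ a (a + ε • w), f a ≤ f x ∧ f x ≤ f a + ε := by
    intro x hx
    rw [segment_eq_image'] at hx
    obtain ⟨t, ⟨h0, h1⟩, rfl⟩ := hx
    simp [hfw]
    constructor <;> nlinarith
  have hk : f (α j) = ((c 0 * A j 0 + c 1 * A j 1 : ℤ) : ℝ) := by
    rw [hc, hA, hA]; push_cast; ring
  set k : ℤ := c 0 * A j 0 + c 1 * A j 1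
  have hv := hbound v hva
  have hu := hbound (v + ℓ j • α j) (hj ▸ right_mem_segment _ _ _)
  simp only [map_add, map_smul, smul_eq_mul, hk] at hu
  have hk0 : k = 0 := by
    by_contra hne
    rcases lt_or_gt_of_ne hne with hlt | hgt
    · have : (k : ℝ) ≤ -1 := by exact_mod_cast Int.le_sub_one_of_lt hlt
      nlinarith
    · have : (1 : ℝ) ≤ k := by exact_mod_cast hgt
      nlinarith
  have hconst : ∀ x ∈ segment ℝ a (a + ε • w), f x = f v := by
    intro x hx
    rw [hj, segment_eq_image'] at hx
    obtain ⟨t, -, rfl⟩ := hx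
    simp [hk, hk0]
  have h1 := hconst _ (left_mem_segment _ _ _)
  have h2 := hconst _ (right_mem_segment _ _ _)
  simp only [map_add, map_smul, smul_eq_mul, hfw] at h2
  linarith

/-- Chopping a corner with size `ε` leaves every other edge of length `ε` intact. -/
lemma IsCornerChop.onShortEdge {Δ Δ' : Set (Pt 2)} {v x : Pt 2} {ε : ℝ} (hΔ : Convex ℝ Δ)
    (h : IsCornerChop Δ v ε Δ') (hx : OnShortEdge Δ ε x) : OnShortEdge Δ' ε x := by
  have hnot := h.not_onShortEdge
  have hvΔ := h.1.1
  obtain ⟨a, b, φ, ψ, hφa, hφb, hψa, hψb, hrep, -, hφ, hψ, htri, rfl⟩ := h.exists_coordinates hΔ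
  obtain ⟨p, w, f, hf, hfw, ⟨hseg, hE⟩, hxp⟩ := hx
  refine ⟨p, w, f, hf, hfw, ⟨hseg, hE.mono (Set.sep_subset _ _) ?_⟩, hxp⟩
  intro y hy
  refine ⟨hE.1 hy, ?_⟩
  by_contra! hlt
  have hφy := hφ y (hE.1 hy)
  have hψy := hψ y (hE.1 hy)
  have hne : v ∉ segment ℝ p (p + ε • w) := fun h =>
    hnot ⟨p, w, f, hf, hfw, ⟨hseg, hE⟩, h⟩
  have hyv : y - v = (φ y - φ v) • a + (ψ y - ψ v) • b := by
    simpa using hrep (y - v)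
  set r := (φ y - φ v) + (ψ y - ψ v) with hr
  have hr0 : 0 ≤ r := by linarith
  have hrε : r < ε := by linarith
  rcases hr0.eq_or_lt with h0 | hrpos
  · have e1 : φ y - φ v = 0 := by linarith
    have e2 : ψ y - ψ v = 0 := by linarith
    rw [e1, e2, zero_smul, zero_smul, add_zero, sub_eq_zero] at hyv
    exact hne (hyv ▸ hy)
  have hεpos : 0 < ε := hrpos.trans hrε
  have hq := htri (ε / r * (φ y - φ v)) (ε / r * (ψ y - ψ v))
    (mul_nonneg (by positivity) (by linarith)) (mul_nonneg (by positivity) (by linarith))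
    (by rw [← mul_add, ← hr]; field_simp; rfl)
  refine hne (hE.2 hvΔ hq hy ⟨1 - r / ε, r / ε, ?_, by positivity, by ring, ?_⟩)
  · rw [sub_pos, div_lt_one hεpos]; exact hrε
  · have hy' : y = v + ((φ y - φ v) • a + (ψ y - ψ v) • b) := by rw [← hyv]; abel
    conv_rhs => rw [hy']
    ext i
    simp
    field_simp
    ring

/-- Every vertex on the cut line lies on the new edge, which has length `ε`. -/
lemma IsCornerChop.extremePoints {Δ Δ' : Set (Pt 2)} {v x : Pt 2} {ε : ℝ} (hΔ : Convex ℝ Δ)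
    (h : IsCornerChop Δ v ε Δ') (hx : x ∈ Set.extremePoints ℝ Δ') :
    OnShortEdge Δ' ε x ∨ x ∈ Set.extremePoints ℝ Δ \ {v} := by
  have hε := h.2.1
  obtain ⟨a, b, φ, ψ, hφa, hφb, hψa, hψb, hrep, hψint, hφ, hψ, htri, rfl⟩ :=
    h.exists_coordinates hΔ
  rcases hx.1.2.eq_or_lt with heq | hlt
  · left
    have hsegment : ∀ y ∈ Δ, φ v + ψ v + ε = φ y + ψ y →
        y ∈ segment ℝ (v + ε • a) (v + ε • a + ε • (b - a)) := by
      intro y hy hyε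
      have := hφ y hy
      have := hψ y hy
      rw [segment_eq_image']
      refine ⟨(ψ y - ψ v) / ε, ⟨div_nonneg (by linarith) hε.le, ?_⟩, ?_⟩
      · rw [div_le_one hε]; linarith
      · have hyv : y - v = (φ y - φ v) • a + (ψ y - ψ v) • b := by
          simpa using hrep (y - v)
        have hy' : y = v + ((φ y - φ v) • a + (ψ y - ψ v) • b) := by rw [← hyv]; abel
        have hφy : φ y - φ v = ε - (ψ y - ψ v) := by linarith
        conv_rhs => rw [hy', hφy]
        ext i
        simp
        field_simp
        ring
    refine ⟨v + ε • a, b - a, ψ, hψint, by simp [hψa, hψb], ⟨⟨_, _, ?_, rfl⟩, ?_, ?_⟩,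
      hsegment x hx.1.1 heq⟩
    · intro hab
      have := congrArg ψ hab
      simp [hψa, hψb] at this
      exact hε.ne' this
    · intro y hy
      rw [segment_eq_image'] at hy
      obtain ⟨t, ⟨h0, h1⟩, rfl⟩ := hy
      refine ⟨?_, ?_⟩
      · convert htri ((1 - t) * ε) (t * ε) (by nlinarith) (by nlinarith) (by linarith) using 1
        ext i
        simp
        ring
      · simp [hφa, hφb, hψa, hψb]
        linarith
    · rintro y ⟨hy, hyε⟩ z ⟨hz, hzε⟩ u hu ⟨s, t, hs, ht, hst, rfl⟩
      refine hsegment y hy (le_antisymm hyε ?_)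
      have hval : φ (s • y + t • z) + ψ (s • y + t • z) = φ v + ψ v + ε := by
        rw [segment_eq_image'] at hu
        obtain ⟨r, -, hr⟩ := hu
        rw [← hr]
        simp [hφa, hφb, hψa, hψb]
        ring
      simp only [map_add, map_smul, smul_eq_mul] at hval
      obtain rfl : s = 1 - t := by linarith
      by_contra! hcon
      nlinarith
  · right
    refine ⟨⟨hx.1.1, ?_⟩, ?_⟩
    · intro y hy z hz hxyz
      have hM : 0 < φ x + ψ x - (φ v + ψ v) := by linarith
      set M := φ x + ψ x - (φ v + ψ v) with hMdef
      set r := (M - ε) / M with hr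
      have hr0 : 0 < r := div_pos (by linarith) hM
      have hr1 : r ≤ 1 := by rw [hr, div_le_one hM]; linarith
      have hrM : r * M = M - ε := by rw [hr]; field_simp
      have hshrink : ∀ u ∈ Δ, x + r • (u - x) ∈ {x ∈ Δ | φ v + ψ v + ε ≤ φ x + ψ x} := by
        intro u hu
        refine ⟨hΔ.add_smul_sub_mem hx.1.1 hu ⟨hr0.le, hr1⟩, ?_⟩
        have := hφ u hu
        have := hψ u hu
        simp only [map_add, map_smul, map_sub, smul_eq_mul]
        nlinarith
      obtain ⟨s, t, hs, ht, hst, hxeq⟩ := hxyz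
      have hyx := hx.2 (hshrink y hy) (hshrink z hz) ⟨s, t, hs, ht, hst, ?_⟩
      · have : r • (y - x) = 0 := by simpa using hyx
        exact sub_eq_zero.1 ((smul_eq_zero.1 this).resolve_left hr0.ne')
      · obtain rfl : s = 1 - t := by linarith
        ext i
        have := congrFun hxeq i
        simp at this ⊢
        linear_combination r * this
    · rintro rfl
      linarith

lemma IsCornerChop.freeVertices_subset {Δ Δ' : Set (Pt 2)} {v : Pt 2} {ε : ℝ}
    (hΔ : Convex ℝ Δ) (h : IsCornerChop Δ v ε Δ') :
    freeVertices Δ' ε ⊆ freeVertices Δ ε \ {v} := by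
  rintro x ⟨hx, hfree⟩
  obtain hx' | hx' := h.extremePoints hΔ hx
  · exact absurd hx' hfree
  · exact ⟨⟨hx'.1, fun hs => hfree (h.onShortEdge hΔ hs)⟩, hx'.2⟩

lemma extremePoints_delzantTriangle_subset :
    Set.extremePoints ℝ (DelzantTriangle 1) ⊆ {![0, 0], ![1, 0], ![0, 1]} := by
  have hhull : DelzantTriangle 1 = convexHull ℝ {![0, 0], ![1, 0], ![0, 1]} := by
    apply subset_antisymm
    · rintro x ⟨h0, h1, h2⟩
      have hc := (convex_convexHull ℝ ({![0, 0], ![1, 0], ![0, 1]} : Set (Pt 2))).sum_mem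
        (t := Finset.univ) (w := ![1 - x 0 - x 1, x 0, x 1])
        (z := ![![0, 0], ![1, 0], ![0, 1]]) ?_ ?_ ?_
      · convert hc using 1
        ext i
        fin_cases i <;> simp [Fin.sum_univ_three]
      · intro i _
        fin_cases i
        · simp; linarith
        · simpa using h0
        · simpa using h1
      · simp [Fin.sum_univ_three]; ring
      · intro i _
        apply subset_convexHull
        fin_cases i <;> simp
    · apply convexHull_min
      · rintro x (rfl | rfl | rfl) <;> simp [DelzantTriangle]
      · rintro x ⟨x0, x1, x2⟩ y ⟨y0, y1, y2⟩ s t hs ht hst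
        refine ⟨?_, ?_, ?_⟩
        · simp; positivity
        · simp; positivity
        · simp; nlinarith
  rw [hhull]
  exact extremePoints_convexHull_subset

/-- One cannot perform four successive corner choppings of equal sizes starting from
the Delzant triangle of size 1. -/
theorem stmt11 :
    ¬ ∃ (ε : ℝ) (Δ : ℕ → Set (Pt 2)), 0 < ε ∧ Δ 0 = DelzantTriangle 1 ∧
      (∀ i ≤ 4, IsDelzant (Δ i)) ∧
      ∀ i < 4, ∃ w, IsCornerChop (Δ i) w ε (Δ (i + 1)) := by
  rintro ⟨ε, Δ, -, h0, hD, hchop⟩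
  have key : ∀ i ≤ 4, (freeVertices (Δ i) ε).Finite ∧ (freeVertices (Δ i) ε).ncard + i ≤ 3 := by
    intro i
    induction i with
    | zero =>
      intro _
      have hsub : freeVertices (Δ 0) ε ⊆ {![0, 0], ![1, 0], ![0, 1]} := by
        rw [h0]
        exact fun x hx => extremePoints_delzantTriangle_subset hx.1
      have hfin : ({![0, 0], ![1, 0], ![0, 1]} : Set (Pt 2)).Finite := Set.toFinite _
      refine ⟨hfin.subset hsub, (Set.ncard_le_ncard hsub hfin).trans ?_⟩
      refine (Set.ncard_insert_le _ _).trans ?_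
      have := Set.ncard_insert_le (![1, 0] : Pt 2) {![0, 1]}
      rw [Set.ncard_singleton] at this
      omega
    | succ i ih =>
      intro hi
      obtain ⟨hfin, hcard⟩ := ih (by omega)
      obtain ⟨w, hw⟩ := hchop i (by omega)
      have hsub := hw.freeVertices_subset (hD i (by omega)).1.2.1
      have hwfree : w ∈ freeVertices (Δ i) ε := ⟨hw.1, hw.not_onShortEdge⟩
      have hlt := Set.ncard_sdiff_singleton_lt_of_mem hwfree hfin
      have hle := Set.ncard_le_ncard hsub hfin.sdiff
      exact ⟨hfin.sdiff.subset hsub, by omega⟩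
  have := (key 4 le_rfl).2
  omega
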